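/- Consider the planar system ẋ = f(x) + ε g(x,t), x = (u,v) ∈ ℝ², where f is C² and Hamiltonian, i.e. f(u,v) = (∂H/∂v (u,v), −∂H/∂u (u,v)) for a C³ function H : ℝ² → ℝ, and g : ℝ² × ℝ → ℝ² is C² and T-periodic in t (g(x,t+T) = g(x,t) for all x, t, with T > 0). Assume there exist an open interval J ⊂ ℝ of energy values and a C¹ period function 𝒯 : J → (0,∞) with 𝒯'(c) ≠ 0 for all c ∈ J, such that for every c ∈ J every solution of the unperturbed system ẋ = f(x) with initial condition on the level set {H = c} is periodic with period 𝒯(c). Let c ∈ J and x₀ ∈ ℝ² with H(x₀) = c satisfy 𝒯(c) = mT/n for coprime positive integers m, n, and let γ : ℝ → ℝ² be the unperturbed solution with γ(0) = x₀. Define the subharmonic Melnikov function M(t₀) = ∫₀^{mT} [f₁(γ(t)) g₂(γ(t), t+t₀) − f₂(γ(t)) g₁(γ(t), t+t₀)] dt. If there exists t̄₀ with M(t̄₀) = 0 and M'(t̄₀) ≠ 0, then there exist ε₀ > 0 and C > 0 such that for every ε ∈ (0, ε₀) there is a point x_ε ∈ ℝ² with ‖x_ε − x₀‖ ≤ Cε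 such that the solution x(t) of ẋ = f(x) + ε g(x,t) with x(t̄₀) = x_ε satisfies x(t̄₀ + mT) = x_ε, and hence is an mT-periodic solution. -/

import Mathlib

open intervalIntegral Set

open Filter Topology in
/-- The superposition operator `y ↦ F ∘ y` on continuous functions over a compact space is strictly
differentiable when `F` is continuously differentiable. -/
theorem ContinuousMap.exists_hasStrictFDerivAt_postcomp {X E G : Type*} [TopologicalSpace X]
    [CompactSpace X] [NormedAddCommGroup E] [NormedSpace ℝ E] [NormedAddCommGroup G]
    [NormedSpace ℝ G] {F : E → G} (hF : ContDiff ℝ 1 F) (y₀ : C(X, E)) :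
    ∃ A : C(X, E) →L[ℝ] C(X, G), (∀ δ x, A δ x = fderiv ℝ F (y₀ x) (δ x)) ∧
      HasStrictFDerivAt (fun y : C(X, E) => (⟨F, hF.continuous⟩ : C(E, G)).comp y) A y₀ := by
  let D : C(E, E →L[ℝ] G) := ⟨fderiv ℝ F, hF.continuous_fderiv one_ne_zero⟩
  let A : C(X, E) →L[ℝ] C(X, G) := LinearMap.mkContinuous
    { toFun := fun δ => ⟨fun x => D (y₀ x) (δ x), by fun_prop⟩
      map_add' := fun δ η => by ext x; simp
      map_smul' := fun r δ => by ext x; simp } ‖D.comp y₀‖ (fun δ => by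
        refine (ContinuousMap.norm_le _ (by positivity)).2 fun x => ?_
        refine ((D (y₀ x)).le_opNorm _).trans ?_
        gcongr
        · exact (D.comp y₀).norm_coe_le_norm x
        · exact δ.norm_coe_le_norm x)
  refine ⟨A, fun δ x => rfl, ?_⟩
  rw [hasStrictFDerivAt_iff_isLittleO, Asymptotics.isLittleO_iff]
  intro c hc
  obtain ⟨r, hr, hD⟩ : ∃ r > 0, ∀ y, dist y y₀ < r → dist (D.comp y) (D.comp y₀) < c :=
    Metric.continuousAt_iff.1 (D.continuous_postcomp.continuousAt (x := y₀)) c hc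
  have key : ∀ x, ∀ a ∈ Metric.ball (y₀ x) r, ‖fderiv ℝ F a - fderiv ℝ F (y₀ x)‖ ≤ c := by
    intro x a ha
    have h1 : dist (y₀ + ContinuousMap.const X (a - y₀ x)) y₀ < r := by
      rw [dist_eq_norm, add_sub_cancel_left]
      refine (ContinuousMap.norm_lt_iff _ hr).2 fun _ => ?_
      simpa [dist_eq_norm] using ha
    have h2 := (ContinuousMap.dist_apply_le_dist (f := D.comp _) (g := D.comp y₀) x).trans
      (hD _ h1).le
    simpa [dist_eq_norm, D] using h2
  filter_upwards [(Metric.ball_mem_nhds (y₀, y₀) hr)] with p hp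
  rw [Metric.mem_ball, Prod.dist_eq, max_lt_iff] at hp
  refine (ContinuousMap.norm_le _ (by positivity)).2 fun x => ?_
  have h := (convex_ball (y₀ x) r).norm_image_sub_le_of_norm_hasFDerivWithin_le'
    (f := F) (f' := fderiv ℝ F) (φ := fderiv ℝ F (y₀ x)) (C := c) (x := p.2 x) (y := p.1 x)
    (fun a _ => ((hF.differentiable one_ne_zero) a).hasFDerivAt.hasFDerivWithinAt) (key x)
    ((ContinuousMap.dist_apply_le_dist x).trans_lt hp.2)
    ((ContinuousMap.dist_apply_le_dist x).trans_lt hp.1)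
  refine h.trans ?_
  gcongr
  exact (p.1 - p.2).norm_coe_le_norm x

/-- The Volterra operator `u ↦ ∫₀ᵗ u` on continuous functions over `[0, b]`. -/
noncomputable def volterra (E : Type*) [NormedAddCommGroup E] [NormedSpace ℝ E]
    {b : ℝ} (hb : 0 ≤ b) : C(Icc 0 b, E) →L[ℝ] C(Icc 0 b, E) :=
  LinearMap.mkContinuous
    { toFun := fun u => ⟨fun t => ∫ s in (0 : ℝ)..t, IccExtend hb u s,
        (continuous_primitive (fun _ _ =>
          u.continuous.Icc_extend'.intervalIntegrable _ _) 0).comp continuous_subtype_val⟩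
      map_add' := fun u v => by
        ext t
        exact integral_add (u.continuous.Icc_extend'.intervalIntegrable _ _)
          (v.continuous.Icc_extend'.intervalIntegrable _ _)
      map_smul' := fun r u => by
        ext t
        exact integral_smul r (IccExtend hb u) } b (fun u => by
    refine (ContinuousMap.norm_le _ (by positivity)).2 fun t => ?_
    refine (norm_integral_le_of_norm_le_const (C := ‖u‖) fun s _ =>
      u.norm_coe_le_norm _).trans ?_
    rw [sub_zero, abs_of_nonneg t.2.1, mul_comm]
    gcongr
    exact t.2.2)

theorem volterra_apply {E : Type*} [NormedAddCommGroup E] [NormedSpace ℝ E]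
    {b : ℝ} (hb : 0 ≤ b) (u : C(Icc 0 b, E)) (t : Icc 0 b) :
    volterra E hb u t = ∫ s in (0 : ℝ)..t, IccExtend hb u s := rfl

theorem norm_volterra_comp_pow_apply_le {E : Type*} [NormedAddCommGroup E] [NormedSpace ℝ E]
    {b : ℝ} (hb : 0 ≤ b) {A : C(Icc 0 b, E) →L[ℝ] C(Icc 0 b, E)} {c : ℝ} (hc : 0 ≤ c)
    (hA : ∀ δ t, ‖A δ t‖ ≤ c * ‖δ t‖) (n : ℕ) (δ : C(Icc 0 b, E)) (t : Icc 0 b) :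
    ‖((volterra E hb ∘L A) ^ n) δ t‖ ≤ (c * t) ^ n / n.factorial * ‖δ‖ := by
  induction n generalizing t with
  | zero => simpa using δ.norm_coe_le_norm t
  | succ n ih =>
    rw [pow_succ']
    set η := ((volterra E hb ∘L A) ^ n) δ
    have h0 : (0 : ℝ) ≤ t := t.2.1
    change ‖∫ s in (0 : ℝ)..t, IccExtend hb (A η) s‖ ≤ _
    have hint : ∫ s in (0 : ℝ)..t, c * ((c * s) ^ n / n.factorial * ‖δ‖)
        = (c * t) ^ (n + 1) / (n + 1).factorial * ‖δ‖ := by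
      have : ∀ s : ℝ, c * ((c * s) ^ n / n.factorial * ‖δ‖)
          = (c ^ (n + 1) / n.factorial * ‖δ‖) * s ^ n := fun s => by ring
      simp_rw [this]
      rw [integral_const_mul, integral_pow, Nat.factorial_succ]
      push_cast
      field_simp
      simp
      ring
    rw [← hint]
    refine norm_integral_le_of_norm_le h0 (Filter.Eventually.of_forall fun s hs => ?_)
      (Continuous.intervalIntegrable (by fun_prop) _ _)
    have hs' : s ∈ Icc 0 b := ⟨hs.1.le, hs.2.trans t.2.2⟩
    rw [IccExtend_of_mem hb _ hs']
    refine (hA _ _).trans ?_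
    gcongr
    exact ih ⟨s, hs'⟩

theorem isUnit_one_sub_volterra_comp {E : Type*} [NormedAddCommGroup E] [NormedSpace ℝ E]
    [CompleteSpace E] {b : ℝ} (hb : 0 ≤ b) {A : C(Icc 0 b, E) →L[ℝ] C(Icc 0 b, E)} {c : ℝ}
    (hc : 0 ≤ c) (hA : ∀ δ t, ‖A δ t‖ ≤ c * ‖δ t‖) : IsUnit (1 - volterra E hb ∘L A) := by
  set L := volterra E hb ∘L A
  obtain ⟨n, hn⟩ := ((FloorSemiring.tendsto_pow_div_factorial_atTop (c * b)).eventually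
    (gt_mem_nhds (show (0 : ℝ) < 1 / 2 by norm_num))).exists
  have hL : ‖L ^ n‖ < 1 := by
    refine (ContinuousLinearMap.opNorm_le_bound _ (by positivity : (0 : ℝ) ≤ 1 / 2) fun δ => ?_
      ).trans_lt (by norm_num)
    refine (ContinuousMap.norm_le _ (by positivity)).2 fun t => ?_
    refine (norm_volterra_comp_pow_apply_le hb hc hA n δ t).trans ?_
    refine mul_le_mul_of_nonneg_right (le_trans ?_ hn.le) (norm_nonneg δ)
    have h0 : (0 : ℝ) ≤ t := t.2.1
    gcongr
    exact t.2.2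
  have hu : IsUnit (1 - L ^ n) := 
    isUnit_one_sub_of_norm_lt_one (R := C(Icc 0 b, E) →L[ℝ] C(Icc 0 b, E)) hL
  rw [← mul_neg_geom_sum] at hu
  refine (Commute.isUnit_mul_iff ?_).1 hu |>.1
  exact (mul_neg_geom_sum L n).trans (geom_sum_mul_neg L n).symm

open Filter Topology in
/-- Differentiable dependence on the initial value of the solutions of an autonomous `C¹`
differential equation near a given solution on a compact time interval. -/
theorem exists_flow_hasStrictFDerivAt {E : Type*} [NormedAddCommGroup E] [NormedSpace ℝ E]
    [CompleteSpace E] {F : E → E} (hF : ContDiff ℝ 1 F) {b : ℝ} (hb : 0 ≤ b) {ζ : ℝ → E}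
    (hζ : ∀ t ∈ Icc 0 b, HasDerivWithinAt ζ (F (ζ t)) (Icc 0 b) t) :
    ∃ Φ : E → ℝ → E,
      (∀ t ∈ Icc 0 b, ∃ Φ' : E →L[ℝ] E, HasStrictFDerivAt (fun z => Φ z t) Φ' (ζ 0)) ∧
      TendstoUniformlyOn Φ ζ (𝓝 (ζ 0)) (Icc 0 b) ∧
      ∀ᶠ z in 𝓝 (ζ 0), Φ z 0 = z ∧
        ∀ t ∈ Icc 0 b, HasDerivWithinAt (Φ z) (F (Φ z t)) (Icc 0 b) t := by
  have hζc : ContinuousOn ζ (Icc 0 b) := fun t ht => (hζ t ht).continuousWithinAt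
  let y₀ : C(Icc 0 b, E) := ⟨fun t => ζ t, hζc.domRestrict⟩
  obtain ⟨A, hA, hN⟩ := ContinuousMap.exists_hasStrictFDerivAt_postcomp hF y₀
  set N : C(Icc 0 b, E) → C(Icc 0 b, E) := fun y => (⟨F, hF.continuous⟩ : C(E, E)).comp y with hNdef
  let D : C(Icc 0 b, E →L[ℝ] E) :=
    ⟨fun t => fderiv ℝ F (y₀ t), (hF.continuous_fderiv one_ne_zero).comp y₀.continuous⟩
  have hu := isUnit_one_sub_volterra_comp hb (A := A) (norm_nonneg D) fun δ t => by
    rw [hA]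
    refine ((fderiv ℝ F (y₀ t)).le_opNorm _).trans ?_
    gcongr
    exact D.norm_coe_le_norm t
  let κ : E →L[ℝ] C(Icc 0 b, E) := LinearMap.mkContinuous
    { toFun := fun z => ContinuousMap.const _ z
      map_add' := fun _ _ => rfl
      map_smul' := fun _ _ => rfl } 1 (fun z => by
        rw [one_mul]
        exact (ContinuousMap.norm_le _ (norm_nonneg z)).2 fun _ => le_rfl)
  let Θ : E × C(Icc 0 b, E) → C(Icc 0 b, E) := fun p => p.2 - κ p.1 - volterra E hb (N p.2)
  have hΘ : HasStrictFDerivAt Θ (ContinuousLinearMap.snd ℝ E _ - κ ∘L .fst ℝ E _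
      - volterra E hb ∘L A ∘L .snd ℝ E _) (ζ 0, y₀) :=
    (hasStrictFDerivAt_snd.sub (κ.hasStrictFDerivAt.comp _ hasStrictFDerivAt_fst)).sub
      ((volterra E hb).hasStrictFDerivAt.comp _
        (HasStrictFDerivAt.comp (ζ 0, y₀) hN hasStrictFDerivAt_snd))
  have hinv : ((ContinuousLinearMap.snd ℝ E _ - κ ∘L .fst ℝ E _
      - volterra E hb ∘L A ∘L .snd ℝ E _) ∘L .inr ℝ E C(Icc 0 b, E)).IsInvertible := by
    obtain ⟨e, he⟩ := hu
    refine ⟨ContinuousLinearEquiv.unitsEquiv ℝ _ e, ?_⟩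
    ext1 δ
    have : (ContinuousLinearEquiv.unitsEquiv ℝ C(Icc 0 b, E) e) δ
      = (1 - volterra E hb ∘L A) δ := by rw [← he]; rfl
    simpa using this
  have hΘ0 : Θ (ζ 0, y₀) = 0 := by
    ext t
    have h1 : ∫ s in (0 : ℝ)..t, IccExtend hb (N y₀) s = ζ t - ζ 0 := by
      have hsub : Icc (0 : ℝ) t ⊆ Icc 0 b := Icc_subset_Icc_right t.2.2
      refine integral_eq_sub_of_hasDeriv_right_of_le t.2.1 (hζc.mono hsub) (fun s hs => ?_)
        ((N y₀).continuous.Icc_extend'.intervalIntegrable _ _)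
      have hs' : s ∈ Icc 0 b := hsub (Ioo_subset_Icc_self hs)
      rw [IccExtend_of_mem hb _ hs']
      exact ((hζ s hs').hasDerivAt (Icc_mem_nhds hs.1 (hs.2.trans_le t.2.2))).hasDerivWithinAt
    simp only [Θ, ContinuousMap.sub_apply, volterra_apply, h1]
    exact sub_self _
  set Y := hΘ.implicitFunctionOfProdDomain hinv with hY
  have hYd := hΘ.hasStrictFDerivAt_implicitFunctionOfProdDomain hinv
  have hY0 : Y (ζ 0) = y₀ :=
    (hΘ.eventually_apply_eq_iff_implicitFunctionOfProdDomain hinv).self_of_nhds.1 rfl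
  have hYe := hΘ.eventually_apply_implicitFunctionOfProdDomain hinv
  simp only [hΘ0] at hYe
  rw [← hY] at hYd hYe
  refine ⟨fun z => IccExtend hb (Y z), fun t ht => ?_, ?_, ?_⟩
  · simp only [IccExtend_of_mem hb _ ht]
    exact ⟨_, (ContinuousMap.evalCLM ℝ (⟨t, ht⟩ : Icc 0 b)).hasStrictFDerivAt.comp _ hYd⟩
  · rw [Metric.tendstoUniformlyOn_iff]
    intro ε hε
    have := hYd.continuousAt.eventually (Metric.ball_mem_nhds _ hε)
    filter_upwards [this] with z hz t ht
    rw [hY0, dist_comm] at hz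
    rw [IccExtend_of_mem hb _ ht]
    exact (ContinuousMap.dist_apply_le_dist (f := y₀) (⟨t, ht⟩ : Icc 0 b)).trans_lt hz
  · filter_upwards [hYe] with z hz
    have hval : ∀ t : Icc 0 b, Y z t = z + ∫ s in (0 : ℝ)..t, F (IccExtend hb (Y z) s) := by
      intro t
      have h1 := DFunLike.congr_fun hz t
      have h2 : Y z t - z - ∫ s in (0 : ℝ)..t, F (IccExtend hb (Y z) s) = 0 := h1
      rw [sub_sub, sub_eq_zero] at h2
      exact h2
    have hc : Continuous fun s => F (IccExtend hb (Y z) s) :=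
      hF.continuous.comp (Y z).continuous.Icc_extend'
    have hval' : ∀ t ∈ Icc 0 b,
        IccExtend hb (Y z) t = z + ∫ s in (0 : ℝ)..t, F (IccExtend hb (Y z) s) := by
      intro t ht
      rw [IccExtend_of_mem hb _ ht]
      exact hval ⟨t, ht⟩
    refine ⟨by simpa using hval' 0 (left_mem_Icc.2 hb), fun t ht => ?_⟩
    exact (((hc.integral_hasStrictDerivAt 0 t).hasDerivAt.const_add z).hasDerivWithinAt).congr
      hval' (hval' t ht)

/-- Uniqueness of solutions of an autonomous `C¹` differential equation on `[0, b]`. -/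
theorem eqOn_Icc_of_hasDerivWithinAt {E : Type*} [NormedAddCommGroup E] [NormedSpace ℝ E]
    [ProperSpace E] {F : E → E} (hF : ContDiff ℝ 1 F) {b : ℝ} {α β : ℝ → E}
    (hα : ∀ t ∈ Icc 0 b, HasDerivWithinAt α (F (α t)) (Icc 0 b) t)
    (hβ : ∀ t ∈ Icc 0 b, HasDerivWithinAt β (F (β t)) (Icc 0 b) t) (h0 : α 0 = β 0) :
    EqOn α β (Icc 0 b) := by
  have hαc : ContinuousOn α (Icc 0 b) := fun t ht => (hα t ht).continuousWithinAt
  have hβc : ContinuousOn β (Icc 0 b) := fun t ht => (hβ t ht).continuousWithinAt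
  obtain ⟨R, hR⟩ := ((isCompact_Icc.image_of_continuousOn hαc).union
    (isCompact_Icc.image_of_continuousOn hβc)).isBounded.subset_closedBall (0 : E)
  obtain ⟨L, hL⟩ := hF.contDiffOn.exists_lipschitzOnWith one_ne_zero
    (convex_closedBall (0 : E) R) (isCompact_closedBall 0 R)
  have hright : ∀ t ∈ Ico 0 b, Icc 0 b ∈ nhdsWithin t (Ici t) := fun t ht =>
    Icc_mem_nhdsGE_of_mem ht
  exact ODE_solution_unique_of_mem_Icc_right (v := fun _ => F)
    (s := fun _ => Metric.closedBall 0 R) (fun _ _ => hL) hαc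
    (fun t ht => (hα t (Ico_subset_Icc_self ht)).mono_of_mem_nhdsWithin (hright t ht))
    (fun t ht => hR (Or.inl (mem_image_of_mem α (Ico_subset_Icc_self ht)))) hβc
    (fun t ht => (hβ t (Ico_subset_Icc_self ht)).mono_of_mem_nhdsWithin (hright t ht))
    (fun t ht => hR (Or.inr (mem_image_of_mem β (Ico_subset_Icc_self ht)))) h0

/-- A solution of a `K`-periodic differential equation on an interval of length `K` that takes the
same value at both ends extends to a `K`-periodic solution on the whole line. -/
theorem exists_periodic_extension {E : Type*} [NormedAddCommGroup E] [NormedSpace ℝ E]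
    {v : ℝ → E → E} {φ : ℝ → E} {a K : ℝ} (hK : 0 < K) (hv : ∀ t x, v (t + K) x = v t x)
    (hφ : ∀ t ∈ Icc a (a + K), HasDerivWithinAt φ (v t (φ t)) (Icc a (a + K)) t)
    (hend : φ (a + K) = φ a) :
    ∃ x : ℝ → E, EqOn x φ (Icc a (a + K)) ∧ ∀ t, HasDerivAt x (v t (x t)) t := by
  let x : ℝ → E := fun t => φ (toIcoMod hK a t)
  have hper : ∀ (t : ℝ) (k : ℤ), x (t + k • K) = x t := fun t k => by simp [x]
  have hvper : ∀ (t : ℝ) (k : ℤ) (y : E), v (t + k • K) y = v t y := fun t k y =>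
    (show Function.Periodic (fun s => v s y) K from fun s => hv s y).zsmul k t
  have hxφ : EqOn x φ (Icc a (a + K)) := by
    intro t ht
    rcases ht.2.eq_or_lt with h | h
    · subst h
      simp [x, hend]
    · simp only [x]
      rw [(toIcoMod_eq_self hK).2 ⟨ht.1, h⟩]
  refine ⟨x, hxφ, fun t => ?_⟩
  have base : ∀ s ∈ Ico a (a + K), HasDerivAt x (v s (x s)) s := by
    intro s hs
    have hs' := Ico_subset_Icc_self hs
    have h1 : HasDerivWithinAt x (v s (x s)) (Icc a (a + K)) s := by
      rw [hxφ hs']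
      exact (hφ s hs').congr hxφ (hxφ hs')
    rcases hs.1.eq_or_lt with h | h
    · subst h
      have hr : a + K ∈ Icc a (a + K) := right_mem_Icc.2 (by linarith)
      have h2 : HasDerivWithinAt (fun t => φ (t + K)) (v a (x a)) (Icc (a - K) a) a := by
        have h3 := hφ _ hr
        rw [hv, hend, ← hxφ hs'] at h3
        have hmaps : MapsTo (fun t => t + K) (Icc (a - K) a) (Icc a (a + K)) :=
          fun t ht => ⟨by linarith [ht.1], by linarith [ht.2]⟩
        simpa [Function.comp_def] using
          h3.scomp a ((hasDerivAt_id' a).add_const K).hasDerivWithinAt hmaps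
      have h5 : ∀ t ∈ Icc (a - K) a, x t = φ (t + K) := fun t ht => by
        have hmem : t + K ∈ Icc a (a + K) := ⟨by linarith [ht.1], by linarith [ht.2]⟩
        rw [← hxφ hmem]
        simpa using (hper t 1).symm
      have h6 := (h2.congr h5 (h5 a ⟨by linarith, le_rfl⟩)).union h1
      refine h6.hasDerivAt ?_
      rw [Icc_union_Icc_eq_Icc (by linarith) (by linarith)]
      exact Icc_mem_nhds (by linarith) (by linarith)
    · exact h1.hasDerivAt (Icc_mem_nhds h hs.2)
  have ht := base (toIcoMod hK a t) (toIcoMod_mem_Ico hK a t)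
  set s := toIcoMod hK a t
  set k := toIcoDiv hK a t
  have hst : t = s + k • K := (toIcoMod_add_toIcoDiv_zsmul hK a t).symm
  rw [hst, hper, hvper]
  have h7 : HasDerivAt x (v s (x s)) (s + k • K - k • K) := by simpa using ht
  refine (h7.comp_sub_const _ _).congr_of_eventuallyEq (Filter.Eventually.of_forall fun r => ?_)
  simpa using hper (r - k • K) k

theorem ContinuousLinearMap.isInvertible_of_injective {E : Type*} [NormedAddCommGroup E]
    [NormedSpace ℝ E] [FiniteDimensional ℝ E] {A : E →L[ℝ] E} (hA : Function.Injective A) :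
    A.IsInvertible :=
  ⟨(LinearEquiv.ofInjectiveEndo (A : E →ₗ[ℝ] E) hA).toContinuousLinearEquiv, by ext; rfl⟩

/-- The linear functional `y ↦ p • y` on the plane. -/
noncomputable def dotCLM (p : ℝ × ℝ) : ℝ × ℝ →L[ℝ] ℝ :=
  p.1 • ContinuousLinearMap.fst ℝ ℝ ℝ + p.2 • ContinuousLinearMap.snd ℝ ℝ ℝ

@[simp] theorem dotCLM_apply (p y : ℝ × ℝ) : dotCLM p y = p.1 * y.1 + p.2 * y.2 := by
  simp [dotCLM]

theorem dotCLM_self_pos {p : ℝ × ℝ} (hp : p ≠ 0) : 0 < dotCLM p p := by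
  rw [dotCLM_apply]
  by_contra! h
  refine hp (Prod.ext ?_ ?_) <;> simp only [Prod.fst_zero, Prod.snd_zero] <;>
    nlinarith [mul_self_nonneg p.1, mul_self_nonneg p.2]

theorem Prod.exists_eq_smul_add_smul_rotate {p : ℝ × ℝ} (hp : p ≠ 0) (y : ℝ × ℝ) :
    ∃ α β : ℝ, y = α • p + β • (-p.2, p.1) := by
  have h : p.1 ^ 2 + p.2 ^ 2 ≠ 0 := by simpa [sq] using (dotCLM_self_pos hp).ne'
  refine ⟨(p.1 * y.1 + p.2 * y.2) / (p.1 ^ 2 + p.2 ^ 2),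
    (-p.2 * y.1 + p.1 * y.2) / (p.1 ^ 2 + p.2 ^ 2), Prod.ext ?_ ?_⟩ <;>
  · simp
    field_simp
    ring

theorem fderiv_apply_of_hamiltonian {f : ℝ × ℝ → ℝ × ℝ} {H : ℝ × ℝ → ℝ}
    (hH : Differentiable ℝ H)
    (hHam : ∀ x : ℝ × ℝ,
      f x = (deriv (fun v => H (x.1, v)) x.2, -deriv (fun u => H (u, x.2)) x.1))
    (x y : ℝ × ℝ) : fderiv ℝ H x y = (f x).1 * y.2 - (f x).2 * y.1 := by
  have hx : HasFDerivAt H (fderiv ℝ H x) (x.1, x.2) := (hH x).hasFDerivAt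
  have h1 : HasDerivAt (fun v => H (x.1, v)) (fderiv ℝ H x (0, 1)) x.2 :=
    hx.comp_hasDerivAt x.2 ((hasDerivAt_const x.2 x.1).prodMk (hasDerivAt_id x.2))
  have h2 : HasDerivAt (fun u => H (u, x.2)) (fderiv ℝ H x (1, 0)) x.1 :=
    hx.comp_hasDerivAt x.1 ((hasDerivAt_id x.1).prodMk (hasDerivAt_const x.1 x.2))
  have hy : y = y.1 • ((1, 0) : ℝ × ℝ) + y.2 • ((0, 1) : ℝ × ℝ) := by ext <;> simp
  rw [hHam x, h1.deriv, h2.deriv]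
  conv_lhs => rw [hy, map_add, map_smul, map_smul]
  simp only [smul_eq_mul]
  ring

open Topology in
/-- Near a point where the Hamiltonian field does not vanish, a point is determined by its energy
and its component along the field. -/
theorem exists_nhds_eq_of_energy_eq {f : ℝ × ℝ → ℝ × ℝ} {H : ℝ × ℝ → ℝ} (hH : ContDiff ℝ 1 H)
    {x₀ : ℝ × ℝ} (hDH : ∀ y, fderiv ℝ H x₀ y = (f x₀).1 * y.2 - (f x₀).2 * y.1)
    (hx₀ : f x₀ ≠ 0) :
    ∃ U ∈ 𝓝 x₀, ∀ y ∈ U, ∀ z ∈ U, H y = H z → dotCLM (f x₀) y = dotCLM (f x₀) z → y = z := by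
  have hd : HasStrictFDerivAt (fun y => (H y, dotCLM (f x₀) y))
      ((fderiv ℝ H x₀).prod (dotCLM (f x₀))) x₀ :=
    (hH.contDiffAt.hasStrictFDerivAt one_ne_zero).prodMk (dotCLM (f x₀)).hasStrictFDerivAt
  have hinj : Function.Injective ((fderiv ℝ H x₀).prod (dotCLM (f x₀))) := by
    rw [injective_iff_map_eq_zero]
    intro y hy
    obtain ⟨α, β, rfl⟩ := Prod.exists_eq_smul_add_smul_rotate hx₀ y
    have hpos := dotCLM_self_pos hx₀
    have h1 : fderiv ℝ H x₀ (α • f x₀ + β • (-(f x₀).2, (f x₀).1)) = 0 := congrArg Prod.fst hy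
    have h2 : dotCLM (f x₀) (α • f x₀ + β • (-(f x₀).2, (f x₀).1)) = 0 := congrArg Prod.snd hy
    simp only [hDH, dotCLM_apply, Prod.fst_add, Prod.snd_add, Prod.smul_fst, Prod.smul_snd,
      smul_eq_mul] at h1 h2 hpos
    have hβ : β = 0 := (mul_eq_zero.1 (by linear_combination h1 :
      β * ((f x₀).1 * (f x₀).1 + (f x₀).2 * (f x₀).2) = 0)).resolve_right hpos.ne'
    have hα : α = 0 := (mul_eq_zero.1 (by linear_combination h2 :
      α * ((f x₀).1 * (f x₀).1 + (f x₀).2 * (f x₀).2) = 0)).resolve_right hpos.ne'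
    simp [hα, hβ]
  obtain ⟨e, he⟩ := ContinuousLinearMap.isInvertible_of_injective hinj
  rw [← he] at hd
  refine ⟨_, hd.eventually_left_inverse, fun y hy z hz hHyz hl => ?_⟩
  rw [← show hd.localInverse _ _ _ _ = y from hy, ← show hd.localInverse _ _ _ _ = z from hz,
    hHyz, hl]

theorem hamiltonian_eq_of_hasDerivWithinAt {f : ℝ × ℝ → ℝ × ℝ} {H : ℝ × ℝ → ℝ}
    (hH : Differentiable ℝ H)
    (hDH : ∀ x y, fderiv ℝ H x y = (f x).1 * y.2 - (f x).2 * y.1) {b : ℝ} {φ : ℝ → ℝ × ℝ}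
    (hφ : ∀ t ∈ Icc 0 b, HasDerivWithinAt φ (f (φ t)) (Icc 0 b) t) {t : ℝ} (ht : t ∈ Icc 0 b) :
    H (φ t) = H (φ 0) := by
  refine eqOn_Icc_of_hasDerivWithinAt (F := fun _ : ℝ => (0 : ℝ)) contDiff_const
    (α := fun t => H (φ t)) (β := fun _ => H (φ 0)) (fun s hs => ?_)
    (fun s _ => hasDerivWithinAt_const _ _ _) rfl ht
  have h := (hH (φ s)).hasFDerivAt.comp_hasDerivWithinAt s (hφ s hs)
  rw [hDH, mul_comm, sub_self] at h
  exact h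

open Filter Topology in
/-- Solutions of a planar Hamiltonian system near a nonconstant periodic one are closed. -/
theorem eventually_exists_return {f : ℝ × ℝ → ℝ × ℝ} {H : ℝ × ℝ → ℝ} (hH : ContDiff ℝ 1 H)
    (hDH : ∀ x y, fderiv ℝ H x y = (f x).1 * y.2 - (f x).2 * y.1)
    {γ : ℝ → ℝ × ℝ} (hγ : ∀ t, HasDerivAt γ (f (γ t)) t) (hf0 : f (γ 0) ≠ 0)
    {K b : ℝ} (hK : 0 < K) (hKb : K < b) (hγK : γ K = γ 0) {φ : ℝ → ℝ → ℝ × ℝ} {l : Filter ℝ}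
    (hφ : ∀ᶠ s in l, ∀ t ∈ Icc 0 b, HasDerivWithinAt (φ s) (f (φ s t)) (Icc 0 b) t)
    (hunif : TendstoUniformlyOn φ γ l (Icc 0 b)) :
    ∀ᶠ s in l, ∃ r ∈ Ioo 0 b, φ s r = φ s 0 := by
  obtain ⟨U, hU, hUinj⟩ := exists_nhds_eq_of_energy_eq hH (hDH (γ 0)) hf0
  obtain ⟨ρ, hρ, hρU⟩ := Metric.mem_nhds_iff.1 hU
  set L := dotCLM (f (γ 0)) with hLdef
  have hγc : Continuous γ := continuous_iff_continuousAt.2 fun t => (hγ t).continuousAt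
  have hnear : ∀ᶠ t in 𝓝 K, t ∈ Ioo 0 b ∧ dist (γ t) (γ 0) < ρ / 2 := by
    refine Filter.Eventually.and (Ioo_mem_nhds hK hKb) ?_
    rw [← hγK]
    exact hγc.continuousAt.eventually (Metric.ball_mem_nhds (γ K) (half_pos hρ))
  obtain ⟨δ, hδ, hball⟩ := Metric.eventually_nhds_iff.1 hnear
  have hq : HasDerivAt (fun t => L (γ t)) (L (f (γ 0))) K := by
    have := L.hasFDerivAt.comp_hasDerivAt K (hγ K)
    rwa [hγK] at this
  have hslope := (hasDerivAt_iff_tendsto_slope.1 hq).eventually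
    (lt_mem_nhds (dotCLM_self_pos hf0))
  obtain ⟨t₁, ht₁, hs₁⟩ := (Filter.Eventually.and
    (Ioo_mem_nhdsLT (show K - δ < K by linarith)) (hslope.filter_mono (nhdsLT_le_nhdsNE K))).exists
  obtain ⟨t₂, ht₂, hs₂⟩ := (Filter.Eventually.and
    (Ioo_mem_nhdsGT (show K < K + δ by linarith)) (hslope.filter_mono (nhdsGT_le_nhdsNE K))).exists
  rw [slope_def_field, hγK] at hs₁ hs₂
  have hq₁ : L (γ t₁) - L (γ 0) < 0 := by
    by_contra! h
    exact absurd (div_nonpos_of_nonneg_of_nonpos h (by linarith [ht₁.2])) (not_le.2 hs₁)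
  have hq₂ : 0 < L (γ t₂) - L (γ 0) := by
    by_contra! h
    exact absurd (div_nonpos_of_nonpos_of_nonneg h (by linarith [ht₂.1])) (not_le.2 hs₂)
  have hIcc : ∀ t ∈ Icc t₁ t₂, t ∈ Ioo 0 b ∧ dist (γ t) (γ 0) < ρ / 2 := fun t ht =>
    hball (by rw [Real.dist_eq, abs_lt]; constructor <;> linarith [ht.1, ht.2, ht₁.1, ht₂.2])
  have h12 : t₁ ≤ t₂ := (ht₁.2.trans ht₂.1).le
  have hmem0 : (0 : ℝ) ∈ Icc 0 b := ⟨le_rfl, (hK.trans hKb).le⟩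
  have hlim : ∀ t ∈ Icc 0 b, Tendsto (fun s => L (φ s t) - L (φ s 0)) l
      (𝓝 (L (γ t) - L (γ 0))) := fun t ht =>
    ((L.continuous.tendsto _).comp (hunif.tendsto_at ht)).sub
      ((L.continuous.tendsto _).comp (hunif.tendsto_at hmem0))
  filter_upwards [hφ, Metric.tendstoUniformlyOn_iff.1 hunif (ρ / 2) (half_pos hρ),
    (hlim t₁ (Ioo_subset_Icc_self (hIcc t₁ ⟨le_rfl, h12⟩).1)).eventually (gt_mem_nhds hq₁),
    (hlim t₂ (Ioo_subset_Icc_self (hIcc t₂ ⟨h12, le_rfl⟩).1)).eventually (lt_mem_nhds hq₂)]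
    with s hs hclose hneg hpos
  have hcont : ContinuousOn (fun t => L (φ s t) - L (φ s 0)) (Icc t₁ t₂) :=
    (L.continuous.comp_continuousOn fun t ht => ((hs t
      (Ioo_subset_Icc_self (hIcc t ht).1)).continuousWithinAt).mono
        fun r hr => Ioo_subset_Icc_self (hIcc r hr).1).sub continuousOn_const
  obtain ⟨r, hr, hr0⟩ := intermediate_value_Icc h12 hcont ⟨hneg.le, hpos.le⟩
  have hr' := Ioo_subset_Icc_self (hIcc r hr).1
  refine ⟨r, (hIcc r hr).1, hUinj _ (hρU ?_) _ (hρU ?_)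
    (hamiltonian_eq_of_hasDerivWithinAt (hH.differentiable one_ne_zero) hDH hs hr')
    (sub_eq_zero.1 hr0)⟩
  · rw [Metric.mem_ball]
    linarith [dist_triangle_left (φ s r) (γ 0) (γ r), hclose r hr', (hIcc r hr).2]
  · rw [Metric.mem_ball, dist_comm]
    linarith [hclose 0 hmem0]

open Filter Topology in
/-- If nearby solutions with energy `e` have period `τ e`, then the displacement over the fixed time
`τ (H (γ 0))` has derivative `-(τ ∘ H)' • f` along any line of initial values. -/
theorem hasDerivAt_displacement {f : ℝ × ℝ → ℝ × ℝ} (hf : ContDiff ℝ 1 f)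
    {H : ℝ × ℝ → ℝ} (hH : ContDiff ℝ 1 H)
    (hDH : ∀ x y, fderiv ℝ H x y = (f x).1 * y.2 - (f x).2 * y.1)
    {γ : ℝ → ℝ × ℝ} (hγ : ∀ t, HasDerivAt γ (f (γ t)) t) (hf0 : f (γ 0) ≠ 0)
    {τ : ℝ → ℝ} {τ' : ℝ} (hτ : HasDerivAt τ τ' (H (γ 0)))
    (hper : ∀ᶠ e in 𝓝 (H (γ 0)), ∀ x : ℝ → ℝ × ℝ,
      (∀ t, HasDerivAt x (f (x t)) t) → H (x 0) = e → x (τ e) = x 0)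
    {K b : ℝ} (hτK : τ (H (γ 0)) = K) (hK : 0 < K) (hKb : K < b)
    {φ : ℝ → ℝ → ℝ × ℝ} {w : ℝ × ℝ}
    (hφ : ∀ᶠ s in 𝓝 0, φ s 0 = γ 0 + s • w ∧
      ∀ t ∈ Icc 0 b, HasDerivWithinAt (φ s) (f (φ s t)) (Icc 0 b) t)
    (hunif : TendstoUniformlyOn φ γ (𝓝 0) (Icc 0 b)) :
    HasDerivAt (fun s => φ s K - (γ 0 + s • w)) (-(τ' * fderiv ℝ H (γ 0) w) • f (γ 0)) 0 := by
  have hγK : γ K = γ 0 := hτK ▸ hper.self_of_nhds γ hγ rfl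
  have hγc : Continuous γ := continuous_iff_continuousAt.2 fun t => (hγ t).continuousAt
  set σ : ℝ → ℝ := fun s => τ (H (γ 0 + s • w)) with hσdef
  have hline : HasDerivAt (fun s : ℝ => γ 0 + s • w) w 0 := by
    simpa using ((hasDerivAt_id (0 : ℝ)).smul_const w).const_add (γ 0)
  have hHline : HasDerivAt (fun s : ℝ => H (γ 0 + s • w)) (fderiv ℝ H (γ 0) w) 0 := by
    refine HasFDerivAt.comp_hasDerivAt (l := H) (0 : ℝ) ?_ hline
    simpa using (hH.differentiable one_ne_zero (γ 0)).hasFDerivAt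
  have hσ0 : σ 0 = K := by simp [σ, hτK]
  have hσ : HasDerivAt σ (τ' * fderiv ℝ H (γ 0) w) 0 :=
    HasDerivAt.comp (0 : ℝ) (by simpa using hτ) hHline
  have hσlim : Tendsto σ (𝓝 0) (𝓝 K) := by simpa [hσ0] using hσ.continuousAt.tendsto
  have hreturn : ∀ᶠ s in 𝓝 0, φ s (σ s) = φ s 0 := by
    have hHlim : Tendsto (fun s : ℝ => H (γ 0 + s • w)) (𝓝 0) (𝓝 (H (γ 0))) := by
      simpa using hHline.continuousAt.tendsto
    filter_upwards [hφ, hHlim.eventually hper, hσlim.eventually (Icc_mem_nhds hK hKb),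
      eventually_exists_return hH hDH hγ hf0 hK hKb hγK (hφ.mono fun _ h => h.2) hunif]
      with s hs hpers hσs ⟨r, hr, hrs⟩
    have hsub : Icc 0 (0 + r) ⊆ Icc 0 b := Icc_subset_Icc_right (by linarith [hr.2])
    obtain ⟨x, hxφ, hx⟩ := exists_periodic_extension (v := fun _ => f) (a := 0) hr.1
      (fun _ _ => rfl) (fun t ht => (hs.2 t (hsub ht)).mono hsub) (by simpa using hrs)
    have hx0 : x 0 = φ s 0 := hxφ ⟨le_rfl, by linarith [hr.1]⟩
    have heq : EqOn x (φ s) (Icc 0 b) :=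
      eqOn_Icc_of_hasDerivWithinAt hf (fun t _ => (hx t).hasDerivWithinAt) hs.2 hx0
    rw [← heq hσs, ← hx0]
    exact hpers x hx (by rw [hx0, hs.1])
  have hB : HasDerivAt (fun s => (K - σ s) • f (γ 0)) (-(τ' * fderiv ℝ H (γ 0) w) • f (γ 0)) 0 :=
    (hσ.const_sub K).smul_const _
  suffices hAB : HasDerivAt (fun s => φ s K - (γ 0 + s • w) - (K - σ s) • f (γ 0)) 0 0 by
    simpa [Pi.add_def] using hAB.add hB
  have hA0 : φ 0 K - (γ 0 + (0 : ℝ) • w) - (K - σ 0) • f (γ 0) = 0 := by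
    have h1 := hreturn.self_of_nhds
    rw [hσ0, hφ.self_of_nhds.1] at h1
    rw [h1, hσ0]
    simp
  rw [hasDerivAt_iff_isLittleO]
  simp only [hA0, sub_zero, smul_zero]
  refine Asymptotics.IsLittleO.trans_isBigO (g := fun s => σ s - σ 0) ?_
    (by simpa using hσ.isBigO_sub)
  rw [Asymptotics.isLittleO_iff]
  intro η hη
  obtain ⟨ρ, hρ, hfρ⟩ := Metric.continuousAt_iff.1 (hf.continuous.continuousAt (x := γ 0)) η hη
  obtain ⟨δ, hδ, hγδ⟩ := Metric.continuousAt_iff.1 (hγc.continuousAt (x := K)) (ρ / 2)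
    (half_pos hρ)
  rw [hγK] at hγδ
  filter_upwards [hφ, hreturn, hσlim.eventually (Icc_mem_nhds hK hKb),
    hσlim.eventually (Metric.ball_mem_nhds K hδ),
    Metric.tendstoUniformlyOn_iff.1 hunif (ρ / 2) (half_pos hρ)] with s hs hret hσs hσδ hclose
  have hS : Convex ℝ (Icc 0 b ∩ Metric.ball K δ) := (convex_Icc 0 b).inter (convex_ball K δ)
  have hmv := hS.norm_image_sub_le_of_norm_hasDerivWithin_le
    (f := fun t => φ s t - t • f (γ 0)) (f' := fun t => f (φ s t) - (1 : ℝ) • f (γ 0)) (C := η)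
    (x := σ s) (y := K)
    (fun t ht => (((hs.2 t ht.1).mono inter_subset_left).sub
      ((hasDerivWithinAt_id t _).smul_const _)))
    (fun t ht => by
      rw [one_smul, ← dist_eq_norm]
      refine (hfρ ?_).le
      linarith [dist_triangle_left (φ s t) (γ 0) (γ t), hclose t ht.1, hγδ ht.2])
    ⟨hσs, hσδ⟩ ⟨⟨hK.le, hKb.le⟩, Metric.mem_ball_self hδ⟩
  simp only [hret] at hmv
  rw [← hs.1, hσ0, norm_sub_rev (σ s) K]
  convert hmv using 2
  module

section ProdDeriv

variable {E F : Type*} [NormedAddCommGroup E] [NormedSpace ℝ E] [NormedAddCommGroup F]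
  [NormedSpace ℝ F] {Z : ℝ → E × F} {Z' : E × F} {s : Set ℝ} {t : ℝ}

theorem hasDerivWithinAt_fst_comp (h : HasDerivWithinAt Z Z' s t) :
    HasDerivWithinAt (fun r => (Z r).1) Z'.1 s t :=
  (ContinuousLinearMap.fst ℝ E F).hasFDerivAt.comp_hasDerivWithinAt t h

theorem hasDerivWithinAt_snd_comp (h : HasDerivWithinAt Z Z' s t) :
    HasDerivWithinAt (fun r => (Z r).2) Z'.2 s t :=
  (ContinuousLinearMap.snd ℝ E F).hasFDerivAt.comp_hasDerivWithinAt t h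

end ProdDeriv

/-- The Melnikov integrand `f ∧ g`. -/
noncomputable def melnikovIntegrand (f : ℝ × ℝ → ℝ × ℝ) (g : ℝ × ℝ → ℝ → ℝ × ℝ) (x : ℝ × ℝ)
    (t : ℝ) : ℝ :=
  (f x).1 * (g x t).2 - (f x).2 * (g x t).1

/-- The perturbed system made autonomous: the state is `(x, t, ε, a)`, where `a` accumulates the
Melnikov integrand along the solution. -/
noncomputable def augmentedField (f : ℝ × ℝ → ℝ × ℝ) (g : ℝ × ℝ → ℝ → ℝ × ℝ)
    (z : (ℝ × ℝ) × ℝ × ℝ × ℝ) : (ℝ × ℝ) × ℝ × ℝ × ℝ :=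
  (f z.1 + z.2.2.1 • g z.1 z.2.1, 1, 0, melnikovIntegrand f g z.1 z.2.1)

section AugmentedField

variable {f : ℝ × ℝ → ℝ × ℝ} {g : ℝ × ℝ → ℝ → ℝ × ℝ}

theorem contDiff_melnikovIntegrand {n : WithTop ℕ∞} (hf : ContDiff ℝ n f)
    (hg : ContDiff ℝ n (fun p : (ℝ × ℝ) × ℝ => g p.1 p.2)) :
    ContDiff ℝ n (fun p : (ℝ × ℝ) × ℝ => melnikovIntegrand f g p.1 p.2) := by
  have hf' : ContDiff ℝ n (fun p : (ℝ × ℝ) × ℝ => f p.1) := hf.comp contDiff_fst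
  exact (hf'.fst.mul hg.snd).sub (hf'.snd.mul hg.fst)

theorem contDiff_augmentedField {n : WithTop ℕ∞} (hf : ContDiff ℝ n f)
    (hg : ContDiff ℝ n (fun p : (ℝ × ℝ) × ℝ => g p.1 p.2)) :
    ContDiff ℝ n (augmentedField f g) := by
  have hπ : ContDiff ℝ n (fun z : (ℝ × ℝ) × ℝ × ℝ × ℝ => (z.1, z.2.1)) := by fun_prop
  have hε : ContDiff ℝ n (fun z : (ℝ × ℝ) × ℝ × ℝ × ℝ => z.2.2.1) := by fun_prop
  exact ((hf.comp contDiff_fst).add (hε.smul (hg.comp hπ))).prodMk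
    (contDiff_const.prodMk (contDiff_const.prodMk ((contDiff_melnikovIntegrand hf hg).comp hπ)))

theorem augmentedField_solution_components {H : ℝ × ℝ → ℝ} (hH : Differentiable ℝ H)
    (hDH : ∀ x y, fderiv ℝ H x y = (f x).1 * y.2 - (f x).2 * y.1) {b : ℝ}
    {Z : ℝ → (ℝ × ℝ) × ℝ × ℝ × ℝ}
    (hZ : ∀ t ∈ Icc 0 b, HasDerivWithinAt Z (augmentedField f g (Z t)) (Icc 0 b) t)
    {x : ℝ × ℝ} {t₀ ε : ℝ} (hZ0 : Z 0 = (x, t₀, ε, 0)) :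
    ∀ t ∈ Icc 0 b,
      HasDerivWithinAt (fun s => (Z s).1) (f (Z t).1 + ε • g (Z t).1 (t₀ + t)) (Icc 0 b) t ∧
      H (Z t).1 = H x + ε * (Z t).2.2.2 := by
  have h1 : ∀ t ∈ Icc 0 b, HasDerivWithinAt (fun s => (Z s).1)
      (f (Z t).1 + (Z t).2.2.1 • g (Z t).1 (Z t).2.1) (Icc 0 b) t := fun t ht =>
    hasDerivWithinAt_fst_comp (hZ t ht)
  have hsnd : ∀ t ∈ Icc 0 b, HasDerivWithinAt (fun s => (Z s).2)
      ((1, 0, melnikovIntegrand f g (Z t).1 (Z t).2.1) : ℝ × ℝ × ℝ) (Icc 0 b) t := fun t ht =>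
    hasDerivWithinAt_snd_comp (hZ t ht)
  have h2 : ∀ t ∈ Icc 0 b, HasDerivWithinAt (fun s => (Z s).2.1) 1 (Icc 0 b) t := fun t ht =>
    hasDerivWithinAt_fst_comp (hsnd t ht)
  have htail : ∀ t ∈ Icc 0 b, HasDerivWithinAt (fun s => (Z s).2.2)
      ((0, melnikovIntegrand f g (Z t).1 (Z t).2.1) : ℝ × ℝ) (Icc 0 b) t := fun t ht =>
    hasDerivWithinAt_snd_comp (hsnd t ht)
  have h3 : ∀ t ∈ Icc 0 b, HasDerivWithinAt (fun s => (Z s).2.2.1) 0 (Icc 0 b) t := fun t ht =>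
    hasDerivWithinAt_fst_comp (htail t ht)
  have h4 : ∀ t ∈ Icc 0 b, HasDerivWithinAt (fun s => (Z s).2.2.2)
      (melnikovIntegrand f g (Z t).1 (Z t).2.1) (Icc 0 b) t := fun t ht =>
    hasDerivWithinAt_snd_comp (htail t ht)
  have htime : EqOn (fun s => (Z s).2.1) (fun s => t₀ + s) (Icc 0 b) :=
    eqOn_Icc_of_hasDerivWithinAt (F := fun _ => (1 : ℝ)) contDiff_const h2
      (fun t _ => (hasDerivWithinAt_id t _).const_add t₀) (by simp [hZ0])
  have hpar : EqOn (fun s => (Z s).2.2.1) (fun _ => ε) (Icc 0 b) :=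
    eqOn_Icc_of_hasDerivWithinAt (F := fun _ => (0 : ℝ)) contDiff_const h3
      (fun t _ => hasDerivWithinAt_const _ _ _) (by simp [hZ0])
  have h1' : ∀ t ∈ Icc 0 b, HasDerivWithinAt (fun s => (Z s).1)
      (f (Z t).1 + ε • g (Z t).1 (t₀ + t)) (Icc 0 b) t := fun t ht => by
    have h := h1 t ht
    rwa [show (Z t).2.1 = t₀ + t from htime ht, show (Z t).2.2.1 = ε from hpar ht] at h
  have henergy : EqOn (fun s => H (Z s).1 - ε * (Z s).2.2.2) (fun _ => H x) (Icc 0 b) := by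
    refine eqOn_Icc_of_hasDerivWithinAt (F := fun _ => (0 : ℝ)) contDiff_const (fun t ht => ?_)
      (fun t _ => hasDerivWithinAt_const _ _ _) (by simp [hZ0])
    have h := ((hH (Z t).1).hasFDerivAt.comp_hasDerivWithinAt t (h1' t ht)).sub
      ((h4 t ht).const_mul ε)
    refine h.congr_deriv ?_
    rw [hDH, show (Z t).2.1 = t₀ + t from htime ht, melnikovIntegrand]
    simp only [Prod.fst_add, Prod.snd_add, Prod.smul_fst, Prod.smul_snd, smul_eq_mul]
    ring
  exact fun t ht => ⟨h1' t ht, by linear_combination henergy ht⟩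

theorem hasDerivAt_augmented_unperturbed (hf : Continuous f)
    (hg : Continuous (fun p : (ℝ × ℝ) × ℝ => g p.1 p.2)) {γ : ℝ → ℝ × ℝ}
    (hγ : ∀ t, HasDerivAt γ (f (γ t)) t) (r t₀ t : ℝ) :
    HasDerivAt (fun t => (γ (r + t), t₀ + t, (0 : ℝ),
        ∫ s in (0 : ℝ)..t, melnikovIntegrand f g (γ (r + s)) (t₀ + s)))
      (augmentedField f g (γ (r + t), t₀ + t, (0 : ℝ),
        ∫ s in (0 : ℝ)..t, melnikovIntegrand f g (γ (r + s)) (t₀ + s))) t := by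
  have hγc : Continuous γ := continuous_iff_continuousAt.2 fun t => (hγ t).continuousAt
  have hW : Continuous fun s => melnikovIntegrand f g (γ (r + s)) (t₀ + s) := by
    have hfc : Continuous fun s => f (γ (r + s)) := by fun_prop
    have hgc : Continuous fun s => g (γ (r + s)) (t₀ + s) :=
      hg.comp (f := fun s => (γ (r + s), t₀ + s)) (by fun_prop)
    exact (hfc.fst.mul hgc.snd).sub (hfc.snd.mul hgc.fst)
  have h1 : HasDerivAt (fun t => γ (r + t)) (f (γ (r + t))) t := (hγ (r + t)).comp_const_add r t
  have h2 : HasDerivAt (fun t => t₀ + t) 1 t := (hasDerivAt_id t).const_add t₀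
  have h4 := (hW.integral_hasStrictDerivAt 0 t).hasDerivAt
  simpa [augmentedField] using h1.prodMk (h2.prodMk ((hasDerivAt_const t (0 : ℝ)).prodMk h4))

theorem integral_melnikovIntegrand_shift {γ : ℝ → ℝ × ℝ} {K : ℝ} (hγ : Function.Periodic γ K)
    (hg : ∀ x, Function.Periodic (g x) K) (r t₀ : ℝ) :
    ∫ s in (0 : ℝ)..K, melnikovIntegrand f g (γ (r + s)) (t₀ + s) =
      ∫ s in (0 : ℝ)..K, melnikovIntegrand f g (γ s) (s + (t₀ - r)) := by
  have hp : Function.Periodic (fun s => melnikovIntegrand f g (γ s) (s + (t₀ - r))) K := by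
    intro s
    simp only [melnikovIntegrand, hγ s, add_right_comm s K, hg (γ s) (s + (t₀ - r))]
  have h1 := hp.intervalIntegral_add_eq r 0
  rw [zero_add] at h1
  rw [← h1]
  have h2 := integral_comp_add_left (a := 0) (b := K)
    (fun s => melnikovIntegrand f g (γ s) (s + (t₀ - r))) r
  rw [add_zero] at h2
  rw [← h2]
  congr 1
  ext s
  congr 1
  ring

end AugmentedField

open Filter Topology in
/-- A plane-valued bifurcation equation `G (ε, x) = 0` whose derivative in `x` is triangular in the
basis `p`, `(-p.2, p.1)` has a branch of zeros with `x = x₀ + O(ε)`. -/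
theorem exists_branch_of_triangular {G : ℝ × ℝ × ℝ → ℝ × ℝ} {G' : ℝ × ℝ × ℝ →L[ℝ] ℝ × ℝ}
    {x₀ p : ℝ × ℝ} (hG : HasStrictFDerivAt G G' (0, x₀)) (hG0 : G (0, x₀) = 0) (hp : p ≠ 0)
    (h1 : (G' (0, p)).1 ≠ 0) (h2 : (G' (0, p)).2 = 0) (h3 : (G' (0, (-p.2, p.1))).2 ≠ 0) :
    ∃ ψ : ℝ → ℝ × ℝ, Tendsto ψ (𝓝 0) (𝓝 x₀) ∧ (∃ C > 0, ∀ᶠ ε in 𝓝 0, ‖ψ ε - x₀‖ ≤ C * ‖ε‖) ∧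
      ∀ᶠ ε in 𝓝 0, G (ε, ψ ε) = 0 := by
  have hinv : (G' ∘L .inr ℝ ℝ (ℝ × ℝ)).IsInvertible := by
    refine ContinuousLinearMap.isInvertible_of_injective ?_
    rw [injective_iff_map_eq_zero]
    intro y hy
    obtain ⟨α, β, rfl⟩ := Prod.exists_eq_smul_add_smul_rotate hp y
    have hy' : α • G' (0, p) + β • G' (0, (-p.2, p.1)) = 0 := by
      rw [map_add, map_smul, map_smul] at hy
      exact hy
    have hb := congrArg Prod.snd hy'
    simp only [Prod.snd_add, Prod.smul_snd, h2, smul_eq_mul, mul_zero, zero_add,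
      Prod.snd_zero] at hb
    have hβ : β = 0 := (mul_eq_zero.1 hb).resolve_right h3
    have ha := congrArg Prod.fst hy'
    simp only [hβ, zero_smul, add_zero, Prod.smul_fst, smul_eq_mul, Prod.fst_zero] at ha
    simp [hβ, (mul_eq_zero.1 ha).resolve_right h1]
  have hψ0 : hG.implicitFunctionOfProdDomain hinv 0 = x₀ :=
    (hG.eventually_apply_eq_iff_implicitFunctionOfProdDomain hinv).self_of_nhds.1 rfl
  refine ⟨hG.implicitFunctionOfProdDomain hinv, hG.tendsto_implicitFunctionOfProdDomain hinv,
    ?_, by simpa [hG0] using hG.eventually_apply_implicitFunctionOfProdDomain hinv⟩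
  obtain ⟨C, hC, hbound⟩ := (hG.hasStrictFDerivAt_implicitFunctionOfProdDomain
    hinv).hasFDerivAt.isBigO_sub.exists_pos
  refine ⟨C, hC, ?_⟩
  simpa [hψ0] using hbound.bound

open Filter Topology in
/-- A simple zero of the Melnikov function over a common period `K` of the forcing and of the
unperturbed orbit `γ` yields `K`-periodic orbits of the perturbed system, provided that the period
varies with the energy. -/
theorem exists_periodic_orbits_of_simple_zero {f : ℝ × ℝ → ℝ × ℝ} (hf : ContDiff ℝ 1 f)
    {H : ℝ × ℝ → ℝ} (hH : ContDiff ℝ 1 H)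
    (hDH : ∀ x y, fderiv ℝ H x y = (f x).1 * y.2 - (f x).2 * y.1)
    {g : ℝ × ℝ → ℝ → ℝ × ℝ} (hg : ContDiff ℝ 1 (fun p : (ℝ × ℝ) × ℝ => g p.1 p.2))
    {K : ℝ} (hK : 0 < K) (hgK : ∀ x, Function.Periodic (g x) K)
    {γ : ℝ → ℝ × ℝ} (hγ : ∀ t, HasDerivAt γ (f (γ t)) t) (hγK : Function.Periodic γ K)
    (hf0 : f (γ 0) ≠ 0) {τ : ℝ → ℝ} {τ' : ℝ} (hτ : HasDerivAt τ τ' (H (γ 0))) (hτ' : τ' ≠ 0)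
    (hτK : τ (H (γ 0)) = K)
    (hper : ∀ᶠ e in 𝓝 (H (γ 0)), ∀ x : ℝ → ℝ × ℝ,
      (∀ t, HasDerivAt x (f (x t)) t) → H (x 0) = e → x (τ e) = x 0)
    {M : ℝ → ℝ} (hM : ∀ t₀, M t₀ = ∫ t in (0 : ℝ)..K, melnikovIntegrand f g (γ t) (t + t₀))
    {tbar : ℝ} (hMzero : M tbar = 0) (hMsimple : deriv M tbar ≠ 0) :
    ∃ ε₀ > (0 : ℝ), ∃ C > (0 : ℝ), ∀ ε ∈ Ioo (0 : ℝ) ε₀,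
      ∃ xε : ℝ × ℝ, ‖xε - γ 0‖ ≤ C * ε ∧
        ∃ x : ℝ → ℝ × ℝ, (∀ t : ℝ, HasDerivAt x (f (x t) + ε • g (x t) t) t) ∧
          x tbar = xε ∧ x (tbar + K) = xε := by
  have hF : ContDiff ℝ 1 (augmentedField f g) := contDiff_augmentedField hf hg
  have hHd : Differentiable ℝ H := hH.differentiable one_ne_zero
  have hγc : Continuous γ := continuous_iff_continuousAt.2 fun t => (hγ t).continuousAt
  have hKb : K ∈ Icc 0 (K + 1) := ⟨hK.le, by linarith⟩
  let Z : ℝ → ℝ → (ℝ × ℝ) × ℝ × ℝ × ℝ := fun r t => (γ (r + t), tbar + t, 0,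
    ∫ s in (0 : ℝ)..t, melnikovIntegrand f g (γ (r + s)) (tbar + s))
  have hZ : ∀ r, ∀ t ∈ Icc 0 (K + 1),
      HasDerivWithinAt (Z r) (augmentedField f g (Z r t)) (Icc 0 (K + 1)) t := fun r t _ =>
    (hasDerivAt_augmented_unperturbed hf.continuous hg.continuous hγ r tbar t).hasDerivWithinAt
  have hZ0 : ∀ r, Z r 0 = (γ r, tbar, 0, 0) := fun r => by simp [Z]
  have hZK : ∀ r, Z r K = (γ r, tbar + K, 0, M (tbar - r)) := fun r => by
    simp only [Z, hγK r, integral_melnikovIntegrand_shift hγK hgK, hM]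
  obtain ⟨Φ, hΦd, hΦu, hΦs⟩ := exists_flow_hasStrictFDerivAt hF (by linarith) (hZ 0)
  obtain ⟨Φ', hΦ'⟩ := hΦd K hKb
  rw [hZ0] at hΦ' hΦu hΦs
  let ι : ℝ × ℝ × ℝ → (ℝ × ℝ) × ℝ × ℝ × ℝ := fun q => (q.2, tbar, q.1, 0)
  have hιC : ContDiff ℝ 1 ι :=
    contDiff_snd.prodMk (contDiff_const.prodMk (contDiff_fst.prodMk contDiff_const))
  have hιd : HasStrictFDerivAt ι _ (0, γ 0) := hιC.hasStrictFDerivAt one_ne_zero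
  have hιc : Continuous ι := hιC.continuous
  have hsol : ∀ᶠ q in 𝓝 ((0 : ℝ), γ 0), Φ (ι q) 0 = ι q ∧ ∀ t ∈ Icc 0 (K + 1),
      HasDerivWithinAt (Φ (ι q)) (augmentedField f g (Φ (ι q) t)) (Icc 0 (K + 1)) t :=
    (hιc.tendsto ((0 : ℝ), γ 0)).eventually hΦs
  let G : ℝ × ℝ × ℝ → ℝ × ℝ := fun q =>
    ((Φ (ι q) K).2.2.2, dotCLM (f (γ 0)) ((Φ (ι q) K).1 - q.2))
  have hΦK : HasStrictFDerivAt (fun q => Φ (ι q) K) _ ((0 : ℝ), γ 0) :=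
    HasStrictFDerivAt.comp (g := fun z => Φ z K) ((0 : ℝ), γ 0) hΦ' hιd
  obtain ⟨G', hG⟩ : ∃ G', HasStrictFDerivAt G G' (0, γ 0) :=
    ⟨_, hΦK.snd.snd.snd.prodMk
      ((dotCLM (f (γ 0))).hasStrictFDerivAt.comp _ (hΦK.fst.sub hasStrictFDerivAt_snd))⟩
  have hγpair : Tendsto (fun r => ((0 : ℝ), γ r)) (𝓝 0) (𝓝 (0, γ 0)) :=
    (continuous_const.prodMk hγc).tendsto 0
  have hGγ : ∀ᶠ r in 𝓝 0, G (0, γ r) = (M (tbar - r), 0) := by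
    filter_upwards [hγpair.eventually hsol] with r hr
    have h := eqOn_Icc_of_hasDerivWithinAt hF hr.2 (hZ r) (by rw [hr.1, hZ0]) hKb
    simp only [G, h, hZK, sub_self, map_zero]
  have hG0 : G (0, γ 0) = 0 := by rw [hGγ.self_of_nhds, sub_zero, hMzero, Prod.mk_zero_zero]
  have hMd : HasDerivAt M (deriv M tbar) tbar :=
    (differentiableAt_of_deriv_ne_zero hMsimple).hasDerivAt
  have hGf : G' (0, f (γ 0)) = (-deriv M tbar, 0) := by
    have h1 : HasDerivAt (fun r => G (0, γ r)) (G' (0, f (γ 0))) 0 :=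
      hG.hasFDerivAt.comp_hasDerivAt (0 : ℝ) ((hasDerivAt_const 0 (0 : ℝ)).prodMk (hγ 0))
    have h2 : HasDerivAt (fun r => M (tbar - r)) (-deriv M tbar) 0 := by
      have h : HasDerivAt M (deriv M tbar) (tbar - 0) := by simpa using hMd
      simpa using h.comp_const_sub tbar 0
    exact h1.unique ((h2.prodMk (hasDerivAt_const 0 (0 : ℝ))).congr_of_eventuallyEq hGγ)
  set w : ℝ × ℝ := (-(f (γ 0)).2, (f (γ 0)).1) with hw
  have hGw : (G' (0, w)).2 ≠ 0 := by
    have hline : Continuous fun s : ℝ => ((0 : ℝ), γ 0 + s • w) := by fun_prop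
    have hline0 : Tendsto (fun s : ℝ => ((0 : ℝ), γ 0 + s • w)) (𝓝 0) (𝓝 (0, γ 0)) := by
      simpa using hline.tendsto 0
    have hι0 : Tendsto (fun s : ℝ => ι (0, γ 0 + s • w)) (𝓝 0) (𝓝 (γ 0, tbar, 0, 0)) :=
      (hιc.tendsto ((0 : ℝ), γ 0)).comp hline0
    have hunif : TendstoUniformlyOn (fun (s : ℝ) t => (Φ (ι (0, γ 0 + s • w)) t).1) γ (𝓝 0)
        (Icc 0 (K + 1)) := by
      have h : TendstoUniformlyOn (fun (s : ℝ) t => Φ (ι (0, γ 0 + s • w)) t) (Z 0) (𝓝 0)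
          (Icc 0 (K + 1)) := fun u hu => hι0.eventually (hΦu u hu)
      have h' := uniformContinuous_fst.comp_tendstoUniformlyOn h
      simpa [Function.comp_def, Z] using h'
    have hdisp := hasDerivAt_displacement hf hH hDH hγ hf0 hτ hper hτK hK (lt_add_one K)
      (φ := fun (s : ℝ) t => (Φ (ι (0, γ 0 + s • w)) t).1) (w := w) (by
        filter_upwards [hline0.eventually hsol] with s hs
        refine ⟨by rw [hs.1], fun t ht => ?_⟩
        simpa using (augmentedField_solution_components hHd hDH hs.2 hs.1 t ht).1) hunif
    have h1 : HasDerivAt (fun s : ℝ => G (0, γ 0 + s • w)) (G' (0, w)) 0 := by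
      refine HasFDerivAt.comp_hasDerivAt (l := G) (0 : ℝ) (by simpa using hG.hasFDerivAt) ?_
      simpa using (hasDerivAt_const (0 : ℝ) (0 : ℝ)).prodMk
        (((hasDerivAt_id (0 : ℝ)).smul_const w).const_add (γ 0))
    have h2 : HasDerivAt (fun s : ℝ => (G (0, γ 0 + s • w)).2) (G' (0, w)).2 0 :=
      (ContinuousLinearMap.snd ℝ ℝ ℝ).hasFDerivAt.comp_hasDerivAt (0 : ℝ) h1
    have h3 := (dotCLM (f (γ 0))).hasFDerivAt.comp_hasDerivAt (0 : ℝ) hdisp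
    have hDw : fderiv ℝ H (γ 0) w = dotCLM (f (γ 0)) (f (γ 0)) := by
      rw [hDH, dotCLM_apply, hw]
      ring
    have hpos := (dotCLM_self_pos hf0).ne'
    rw [h2.unique h3, map_smul, hDw, smul_eq_mul]
    exact mul_ne_zero (neg_ne_zero.2 (mul_ne_zero hτ' hpos)) hpos
  obtain ⟨ψ, hψ, ⟨C, hC, hψC⟩, hψG⟩ := exists_branch_of_triangular hG hG0 hf0
    (by simpa [hGf] using hMsimple) (by rw [hGf]) hGw
  obtain ⟨U, hU, hinj⟩ := exists_nhds_eq_of_energy_eq hH (hDH (γ 0)) hf0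
  have hψpair : Tendsto (fun ε => (ε, ψ ε)) (𝓝 0) (𝓝 (0, γ 0)) := tendsto_id.prodMk_nhds hψ
  have hreturn : Tendsto (fun ε => (Φ (ι (ε, ψ ε)) K).1) (𝓝 0) (𝓝 (γ 0)) := by
    have h0 : Φ (ι (0, γ 0)) K = Z 0 K :=
      eqOn_Icc_of_hasDerivWithinAt hF hsol.self_of_nhds.2 (hZ 0)
        (by rw [hsol.self_of_nhds.1, hZ0]) hKb
    have h := hΦK.continuousAt.fst.tendsto.comp hψpair
    simpa [h0, hZK, Function.comp_def] using h
  have hall : ∀ᶠ ε in 𝓝 0, ‖ψ ε - γ 0‖ ≤ C * ‖ε‖ ∧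
      ∃ x : ℝ → ℝ × ℝ, (∀ t : ℝ, HasDerivAt x (f (x t) + ε • g (x t) t) t) ∧
        x tbar = ψ ε ∧ x (tbar + K) = ψ ε := by
    filter_upwards [hψC, hψG, hψ hU, hreturn hU, hψpair.eventually hsol]
      with ε hbound hGε hψU hretU hε
    refine ⟨hbound, ?_⟩
    have hcomp := augmentedField_solution_components hHd hDH hε.2 hε.1
    have hΦ0 : (Φ (ι (ε, ψ ε)) 0).1 = ψ ε := by rw [hε.1]
    have hGε1 : (Φ (ι (ε, ψ ε)) K).2.2.2 = 0 := congrArg Prod.fst hGε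
    have hGε2 : dotCLM (f (γ 0)) ((Φ (ι (ε, ψ ε)) K).1 - ψ ε) = 0 := congrArg Prod.snd hGε
    have hret : (Φ (ι (ε, ψ ε)) K).1 = ψ ε := by
      refine hinj _ hretU _ hψU ?_ ?_
      · simpa [hGε1] using (hcomp K hKb).2
      · rwa [map_sub, sub_eq_zero] at hGε2
    have hseg : ∀ t ∈ Icc tbar (tbar + K), HasDerivWithinAt
        (fun t => (Φ (ι (ε, ψ ε)) (t - tbar)).1)
        (f (Φ (ι (ε, ψ ε)) (t - tbar)).1 + ε • g (Φ (ι (ε, ψ ε)) (t - tbar)).1 t)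
        (Icc tbar (tbar + K)) t := fun t ht => by
      have ht' : t - tbar ∈ Icc 0 (K + 1) := ⟨by linarith [ht.1], by linarith [ht.2]⟩
      have hmaps : MapsTo (fun s => s - tbar) (Icc tbar (tbar + K)) (Icc 0 (K + 1)) :=
        fun s hs => ⟨by linarith [hs.1], by linarith [hs.2]⟩
      simpa [Function.comp_def] using (hcomp _ ht').1.scomp t
        ((hasDerivAt_id' t).sub_const tbar).hasDerivWithinAt hmaps
    obtain ⟨x, hxφ, hx⟩ := exists_periodic_extension hK (v := fun t y => f y + ε • g y t)
      (fun t y => by simp only [hgK y t]) hseg (by simp [hret, hΦ0])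
    refine ⟨x, hx, ?_, ?_⟩
    · simpa [hΦ0] using hxφ (left_mem_Icc.2 (by linarith))
    · simpa [hret] using hxφ (right_mem_Icc.2 (by linarith))
  obtain ⟨ε₀, hε₀, hball⟩ := Metric.eventually_nhds_iff.1 hall
  refine ⟨ε₀, hε₀, C, hC, fun ε hε => ⟨ψ ε, ?_⟩⟩
  have h := hball (y := ε) (by simpa [abs_of_pos hε.1] using hε.2)
  rwa [Real.norm_of_nonneg hε.1.le] at h

/-- subharmonic Melnikov theorem.  Consider the planar system
`ẋ = f(x) + ε g(x,t)` where `f` is C² and Hamiltonian with C³ Hamiltonian `H`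
(`f = (∂H/∂v, -∂H/∂u)`), and `g` is C² and `T`-periodic in `t`.  Assume there is an
open interval `J` of energies and a C¹ period function `𝒯 : J → (0,∞)` with
`𝒯' ≠ 0` on `J`, such that every unperturbed solution starting on the level set
`{H = c}`, `c ∈ J`, is periodic with period `𝒯(c)`.  Let `c ∈ J`, `H(x₀) = c`,
`𝒯(c) = mT/n` with `m, n` coprime positive integers, and let `γ` be the unperturbed
solution with `γ(0) = x₀`.  If the subharmonic Melnikov function
`M(t₀) = ∫₀^{mT} f(γ(t)) ∧ g(γ(t), t + t₀) dt` has a simple zero `t̄₀`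
(`M(t̄₀) = 0`, `M'(t̄₀) ≠ 0`), then there are `ε₀ > 0` and `C > 0` such that for every
`ε ∈ (0, ε₀)` there is `x_ε` with `‖x_ε - x₀‖ ≤ C ε` and a solution of the perturbed
system with `x(t̄₀) = x_ε` and `x(t̄₀ + mT) = x_ε`, hence an `mT`-periodic solution. -/
theorem melnikov_subharmonic_periodic_orbits
    (T : ℝ) (hT : 0 < T)
    (f : ℝ × ℝ → ℝ × ℝ) (hf : ContDiff ℝ 2 f)
    (H : ℝ × ℝ → ℝ) (hH : ContDiff ℝ 3 H)
    (hHam : ∀ x : ℝ × ℝ,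
      f x = (deriv (fun v => H (x.1, v)) x.2, -deriv (fun u => H (u, x.2)) x.1))
    (g : ℝ × ℝ → ℝ → ℝ × ℝ) (hg : ContDiff ℝ 2 (fun p : (ℝ × ℝ) × ℝ => g p.1 p.2))
    (hgper : ∀ (x : ℝ × ℝ) (t : ℝ), g x (t + T) = g x t)
    -- an open interval of energy values and a C¹ period function with 𝒯' ≠ 0 :
    (J : Set ℝ) (hJopen : IsOpen J) (hJconn : J.OrdConnected)
    (𝒯 : ℝ → ℝ) (h𝒯 : ContDiffOn ℝ 1 𝒯 J)
    (h𝒯pos : ∀ c ∈ J, 0 < 𝒯 c)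
    (h𝒯' : ∀ c ∈ J, deriv 𝒯 c ≠ 0)
    -- every unperturbed solution on an energy level in J is periodic with period 𝒯 c :
    (hperiodic : ∀ c ∈ J, ∀ γ : ℝ → ℝ × ℝ,
      (∀ t : ℝ, HasDerivAt γ (f (γ t)) t) → H (γ 0) = c → ∀ t : ℝ, γ (t + 𝒯 c) = γ t)
    -- the resonant unperturbed orbit :
    (c : ℝ) (hc : c ∈ J) (x₀ : ℝ × ℝ) (hx₀ : H x₀ = c)
    (m n : ℕ) (hm : 0 < m) (hn : 0 < n) (hmn : Nat.Coprime m n)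
    (hres : 𝒯 c = (m : ℝ) * T / (n : ℝ))
    (γ : ℝ → ℝ × ℝ) (hγ : ∀ t : ℝ, HasDerivAt γ (f (γ t)) t) (hγ0 : γ 0 = x₀)
    -- the subharmonic Melnikov function and its simple zero :
    (M : ℝ → ℝ)
    (hM : ∀ t₀ : ℝ, M t₀ = ∫ t in (0:ℝ)..((m : ℝ) * T),
        (f (γ t)).1 * (g (γ t) (t + t₀)).2 - (f (γ t)).2 * (g (γ t) (t + t₀)).1)
    (tbar : ℝ) (hMzero : M tbar = 0) (hMsimple : deriv M tbar ≠ 0) :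
    ∃ ε₀ > (0 : ℝ), ∃ C > (0 : ℝ), ∀ ε ∈ Ioo (0 : ℝ) ε₀,
      ∃ xε : ℝ × ℝ, ‖xε - x₀‖ ≤ C * ε ∧
        ∃ x : ℝ → ℝ × ℝ,
          (∀ t : ℝ, HasDerivAt x (f (x t) + ε • g (x t) t) t) ∧
          x tbar = xε ∧ x (tbar + (m : ℝ) * T) = xε := by
  subst hγ0
  have hf1 : ContDiff ℝ 1 f := hf.of_le one_le_two
  have hH1 : ContDiff ℝ 1 H := hH.of_le (by norm_num)
  have hDH := fderiv_apply_of_hamiltonian (hH1.differentiable one_ne_zero) hHam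
  have hnpos : (0 : ℝ) < n := Nat.cast_pos.2 hn
  have hK : (0 : ℝ) < m * T := mul_pos (Nat.cast_pos.2 hm) hT
  have hnK : (n : ℝ) * 𝒯 c = m * T := by rw [hres]; field_simp
  have hret : ∀ e ∈ J, ∀ x : ℝ → ℝ × ℝ, (∀ t, HasDerivAt x (f (x t)) t) → H (x 0) = e →
      Function.Periodic x (n * 𝒯 e) := fun e he x hx hxe =>
    Function.Periodic.nat_mul (hperiodic e he x hx hxe) n
  have hf0 : f (γ 0) ≠ 0 := by
    intro h0
    have hconst : EqOn γ (fun _ => γ 0) (Icc 0 (m * T)) :=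
      eqOn_Icc_of_hasDerivWithinAt hf1 (fun t _ => (hγ t).hasDerivWithinAt)
        (fun t _ => by simpa only [h0] using hasDerivWithinAt_const t _ (γ 0)) rfl
    have hM0 : M = fun _ => 0 := by
      funext t₀
      rw [hM, integral_congr (g := fun _ => (0 : ℝ)) fun t ht => ?_, integral_zero]
      rw [uIcc_of_le hK.le] at ht
      simp [hconst ht, h0]
    simp [hM0] at hMsimple
  have hJ : J ∈ nhds c := hJopen.mem_nhds hc
  have hτ : HasDerivAt (fun e => n * 𝒯 e) (n * deriv 𝒯 c) c :=
    (((h𝒯.differentiableOn one_ne_zero).differentiableAt hJ).hasDerivAt).const_mul _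
  subst hx₀
  exact exists_periodic_orbits_of_simple_zero hf1 hH1 hDH (hg.of_le one_le_two) hK
    (fun x => Function.Periodic.nat_mul (hgper x) m) hγ (hnK ▸ hret _ hc γ hγ rfl) hf0 hτ
    (mul_ne_zero hnpos.ne' (h𝒯' _ hc)) hnK
    (Filter.mem_of_superset hJ fun e he x hx hxe => by simpa using hret e he x hx hxe 0)
    hM hMzero hMsimple
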